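/- Let $A$ be a commutative regular local Noetherian ring and $M$ a finitely generated $A$-module. Then the codimension of the support of $M$ equals $\inf\{ j \geq 0 : \mathrm{Ext}^j_A(M, A) \neq 0 \}$ (with the convention that both sides are $+\infty$ when $M = 0$). -/

import Mathlib

open CategoryTheory

universe w v u

section

open IsLocalRing RingTheory.Sequence

theorem IsLocalRing.exists_mem_maximalIdeal_notMem_sq_notMem_minimalPrimes {A : Type*}
    [CommRing A] [IsNoetherianRing A] [IsLocalRing A] (h : 0 < ringKrullDim A) :
    ∃ x ∈ maximalIdeal A, x ∉ maximalIdeal A ^ 2 ∧ ∀ P ∈ minimalPrimes A, x ∉ P := by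
  have hm : ¬ ∃ P ∈ minimalPrimes A, maximalIdeal A ≤ P := by
    rintro ⟨P, hP, hle⟩
    have := hP.1.1
    have e : maximalIdeal A = P := le_antisymm hle (le_maximalIdeal hP.1.1.ne_top)
    rw [← maximalIdeal_height_eq_ringKrullDim, e, Ideal.height_eq_zero_iff.2 hP] at h
    simp at h
  have hsq : ¬ maximalIdeal A ≤ maximalIdeal A ^ 2 := by
    intro hle
    have hb := Submodule.eq_bot_of_le_smul_of_le_jacobson_bot (maximalIdeal A) (maximalIdeal A)
      (IsNoetherian.noetherian _) (by simpa [sq] using hle) (maximalIdeal_le_jacobson _)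
    obtain ⟨P, hP, -⟩ := Ideal.exists_minimalPrimes_le
      (bot_le : (⊥ : Ideal A) ≤ maximalIdeal A)
    exact hm ⟨P, hP, by simp [hb]⟩
  by_contra! H
  have hfin := Ideal.finite_minimalPrimes_of_isNoetherianRing A ⊥
  rcases (Ideal.subset_union_prime' (s := hfin.toFinset) (f := id)
    (a := maximalIdeal A ^ 2) (b := maximalIdeal A ^ 2) (I := maximalIdeal A)
    fun P hP => (hfin.mem_toFinset.1 hP).1.1).1 (fun x hx => by
      by_cases hx2 : x ∈ maximalIdeal A ^ 2
      · exact .inl (.inl hx2)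
      · obtain ⟨P, hP, hxP⟩ := H x hx hx2
        exact .inr (Set.mem_biUnion (by simpa using hP) hxP)) with h | h | ⟨P, hP, hle⟩
  · exact hsq h
  · exact hsq h
  · exact hm ⟨P, hfin.mem_toFinset.1 hP, hle⟩

theorem IsLocalRing.exists_span_pair_sup_eq_maximalIdeal {A : Type*} [CommRing A] [IsLocalRing A]
    [DecidableEq A] {s : Finset A} (hs : Ideal.span (s : Set A) = maximalIdeal A) {x : A}
    (hx : x ∈ maximalIdeal A) (hx2 : x ∉ maximalIdeal A ^ 2) :
    ∃ y ∈ s, Ideal.span {x} ⊔ Ideal.span (s.erase y : Set A) = maximalIdeal A := by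
  have hsm : ∀ a ∈ s, a ∈ maximalIdeal A := fun a ha => hs ▸ Ideal.subset_span ha
  obtain ⟨c, -, hc⟩ := Submodule.mem_span_finset.1 (show x ∈ Ideal.span (s : Set A) by rwa [hs])
  obtain ⟨y, hy, hcy⟩ : ∃ y ∈ s, IsUnit (c y) := by
    by_contra! H
    refine hx2 (hc ▸ Ideal.sum_mem _ fun a ha => ?_)
    rw [sq]
    exact Ideal.mul_mem_mul (H a ha) (hsm a ha)
  refine ⟨y, hy, le_antisymm (sup_le ?_ ?_) ?_⟩
  · simpa [Ideal.span_le] using hx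
  · rw [← hs]
    exact Ideal.span_mono (by simp)
  · rw [← hs, Ideal.span_le]
    intro a ha
    by_cases hay : a = y
    · subst hay
      rw [← Finset.add_sum_erase _ _ ha] at hc
      rw [SetLike.mem_coe, ← Ideal.unit_mul_mem_iff_mem _ hcy, ← smul_eq_mul, eq_sub_of_add_eq hc]
      exact sub_mem (Ideal.mem_sup_left (Ideal.mem_span_singleton_self x))
        (Ideal.mem_sup_right (Ideal.sum_mem _ fun b hb =>
          Ideal.mul_mem_left _ _ (Ideal.subset_span hb)))
    · exact Ideal.mem_sup_right (Ideal.subset_span (by simp [hay, Finset.mem_coe.1 ha]))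

theorem IsLocalRing.eq_bot_of_isPrime_of_le_span_singleton {A : Type*} [CommRing A]
    [IsNoetherianRing A] [IsLocalRing A] {x : A} (hx : x ∈ maximalIdeal A) {Q : Ideal A}
    [Q.IsPrime] (hQ : Q ≤ Ideal.span {x}) (hxQ : x ∉ Q) : Q = ⊥ := by
  refine Submodule.eq_bot_of_le_smul_of_le_jacobson_bot (maximalIdeal A) Q
    (IsNoetherian.noetherian _) (fun q hq => ?_) (maximalIdeal_le_jacobson _)
  obtain ⟨a, rfl⟩ := Ideal.mem_span_singleton.1 (hQ hq)
  exact Ideal.mul_mem_mul hx ((Ideal.IsPrime.mem_or_mem ‹_› hq).resolve_left hxQ)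

theorem IsLocalRing.isDomain_and_exists_isWeaklyRegular_of_card_le_ringKrullDim (n : ℕ) {A : Type*}
    [CommRing A] [IsNoetherianRing A] [IsLocalRing A] (s : Finset A)
    (hs : Ideal.span (s : Set A) = maximalIdeal A) (hcard : s.card ≤ n)
    (hdim : n ≤ ringKrullDim A) :
    IsDomain A ∧ ∃ rs : List A, rs.length = n ∧ (∀ r ∈ rs, r ∈ maximalIdeal A) ∧
      IsWeaklyRegular A rs := by
  classical
  induction n generalizing A with
  | zero =>
    obtain rfl : s = ∅ := by simpa using hcard
    refine ⟨?_, [], by simp⟩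
    have : IsField A := isField_iff_maximalIdeal_eq.2 (by simpa using hs.symm)
    exact this.isDomain
  | succ n ih =>
    obtain ⟨x, hx, hx2, hxP⟩ := exists_mem_maximalIdeal_notMem_sq_notMem_minimalPrimes
      (A := A) (lt_of_lt_of_le (by exact_mod_cast n.succ_pos) hdim)
    obtain ⟨y, hy, hspan⟩ := exists_span_pair_sup_eq_maximalIdeal hs hx hx2
    have hxtop : Ideal.span {x} ≠ ⊤ := fun h =>
      hx (Ideal.span_singleton_eq_top.1 h)
    have : Nontrivial (A ⧸ Ideal.span {x}) := Ideal.Quotient.nontrivial_iff.2 hxtop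
    have hsurj := Ideal.Quotient.mk_surjective (I := Ideal.span {x})
    have : IsLocalRing (A ⧸ Ideal.span {x}) := .of_surjective' _ hsurj
    have hmap := map_maximalIdeal_of_surjective _ hsurj
    have hdim' : n ≤ ringKrullDim (A ⧸ Ideal.span {x}) := by
      have h1 := ringKrullDim_le_ringKrullDim_quotient_add_card {x} (by
        simpa [ringJacobson_eq_maximalIdeal] using hx)
      rw [Finset.coe_singleton] at h1
      exact ENat.WithBot.add_le_add_natCast_right_iff.1 (hdim.trans h1)
    obtain ⟨hdom, rs', hlen, hmem, hreg⟩ := ih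
      ((s.erase y).image (Ideal.Quotient.mk (Ideal.span {x}))) (by
        rw [Finset.coe_image, ← Ideal.map_span, ← hmap, ← hspan, Ideal.map_sup,
          Ideal.map_quotient_self, bot_sup_eq])
      (Finset.card_image_le.trans (by rw [Finset.card_erase_of_mem hy]; omega)) hdim'
    have hprime : (Ideal.span {x}).IsPrime := (Ideal.Quotient.isDomain_iff_prime _).1 hdom
    obtain ⟨Q, hQ, hQx⟩ := Ideal.exists_minimalPrimes_le (bot_le : ⊥ ≤ Ideal.span {x})
    have := hQ.1.1
    have hdomA : IsDomain A := by
      have := eq_bot_of_isPrime_of_le_span_singleton hx hQx (hxP Q hQ)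
      subst this
      exact IsDomain.of_bot_isPrime A
    have hx0 : x ≠ 0 := by
      rintro rfl
      exact hx2 (zero_mem _)
    obtain ⟨rs, rfl⟩ := hsurj.list_map rs'
    refine ⟨hdomA, x :: rs, by simpa using hlen, ?_, ?_⟩
    · simp only [List.mem_cons, forall_eq_or_imp]
      refine ⟨hx, fun r hr hu => ?_⟩
      exact hmem _ (List.mem_map_of_mem hr) (hu.map _)
    · refine (isWeaklyRegular_cons_iff A x rs).2 ⟨IsSMulRegular.of_ne_zero hx0, ?_⟩
      have := (isWeaklyRegular_map_algebraMap_iff (A ⧸ Ideal.span {x}) _ rs).1 hreg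
      refine ((Submodule.quotEquivOfEq _ _ ?_).isWeaklyRegular_congr rs).1 this
      simp [← Submodule.ideal_span_singleton_smul]

theorem exists_isSMulRegular_quotient_of_isRadical {A : Type*} [CommRing A] [IsNoetherianRing A]
    [IsLocalRing A] {I : Ideal A} (hI : I.IsRadical) (hlt : I < maximalIdeal A) :
    ∃ x ∈ maximalIdeal A, IsSMulRegular (A ⧸ I) x := by
  suffices Subsingleton ((A ⧸ maximalIdeal A) →ₗ[A] (A ⧸ I)) by
    simpa [Ideal.annihilator_quotient] using IsSMulRegular.subsingleton_linearMap_iff.1 this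
  refine subsingleton_of_forall_eq 0 fun f => ?_
  ext
  obtain ⟨y, hy⟩ := Ideal.Quotient.mk_surjective (f 1)
  have hmul : ∀ a ∈ maximalIdeal A, a * y ∈ I := fun a ha => by
    rw [← Ideal.Quotient.eq_zero_iff_mem, map_mul, hy, ← Ideal.Quotient.algebraMap_eq,
      ← Algebra.smul_def, ← map_smul, ← map_zero f]
    congr 1
    rw [Algebra.smul_def, mul_one]
    exact Ideal.Quotient.eq_zero_iff_mem.2 ha
  have hyI : y ∈ I := by
    by_cases hym : y ∈ maximalIdeal A
    · exact hI ⟨2, by simpa [sq] using hmul y hym⟩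
    · have hu : IsUnit y := by simpa using hym
      exact absurd (fun a ha => (Ideal.mul_unit_mem_iff_mem I hu).1 (hmul a ha)) hlt.not_ge
  change f 1 = 0
  rw [← hy]
  exact Ideal.Quotient.eq_zero_iff_mem.2 hyI

open Abelian in
theorem ModuleCat.subsingleton_ext_of_subsingleton_ext_quotSMulTop {A : Type u} [CommRing A]
    [IsNoetherianRing A] [IsLocalRing A] (B N : ModuleCat.{u} A) [Module.Finite A B]
    [Module.Finite A N] {x : A} (hx : x ∈ maximalIdeal A) (hreg : IsSMulRegular B x) (i : ℕ)
    (h : Subsingleton (Ext (ModuleCat.of A (QuotSMulTop x B)) N (i + 1))) :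
    Subsingleton (Ext B N i) := by
  suffices (⊤ : Submodule A (Ext B N i)) = ⊥ from (Submodule.subsingleton_iff A).1
    (subsingleton_of_bot_eq_top this.symm)
  refine Submodule.eq_bot_of_le_smul_of_le_jacobson_bot (maximalIdeal A) ⊤
    (IsNoetherian.noetherian _) (fun y _ => ?_) (maximalIdeal_le_jacobson _)
  obtain ⟨(z : Ext B N i), (hz : (Ext.mk₀ (x • 𝟙 B)).comp z _ = y)⟩ :=
    Ext.contravariant_sequence_exact₁ hreg.smulShortComplex_shortExact
      (Y := N) y (n₁ := i + 1) (add_comm _ _) (h.elim _ _)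
  have : x • z = y := by simp [← hz, Ext.mk₀_smul]
  rw [← this]
  exact Submodule.smul_mem_smul hx trivial

open Abelian in
theorem ModuleCat.subsingleton_ext_of_add_supportDim_lt {A : Type u} [CommRing A]
    [IsNoetherianRing A] [IsLocalRing A] {rs : List A} (hmem : ∀ r ∈ rs, r ∈ maximalIdeal A)
    (L : ModuleCat.{u} A) [Module.Finite A L] [Nontrivial L]
    (hreg : IsWeaklyRegular L rs) (e : ℕ) (N : ModuleCat.{u} A) [Module.Finite A N]
    [Nontrivial N] (hN : Module.supportDim A N ≤ e) (i : ℕ) (hi : i + e < rs.length) :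
    Subsingleton (Ext N L i) := by
  have hlt (I : Ideal A) (hI : I ≤ maximalIdeal A) : I • (⊤ : Submodule A L) < ⊤ :=
    (Submodule.top_ne_ideal_smul_of_le_jacobson_annihilator
      (hI.trans (maximalIdeal_le_jacobson _))).symm.lt_top
  induction e using Nat.strong_induction_on generalizing N i with
  | _ e ih =>
    have hsupp : Module.support A N = PrimeSpectrum.zeroLocus (Module.annihilator A N).radical := by
      rw [PrimeSpectrum.zeroLocus_radical, Module.support_eq_zeroLocus]
    set I := (Module.annihilator A N).radical with hI
    have hIm : I ≤ maximalIdeal A := le_maximalIdeal (by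
      simpa [hI, Ideal.radical_eq_top, Module.annihilator_eq_top_iff] using not_subsingleton N)
    rcases hIm.eq_or_lt with heq | hIlt
    · exact subsingleton_ext_of_exists_isRegular I N hsupp.subset L (hlt I hIm) rs (heq ▸ hmem)
        (.of_isWeaklyRegular_of_mem_maximalIdeal L hmem hreg) i (by omega)
    · obtain ⟨x, hx, hxreg⟩ :=
        exists_isSMulRegular_quotient_of_isRadical (Ideal.radical_isRadical _) hIlt
      have : Nontrivial (A ⧸ I) := Ideal.Quotient.nontrivial_iff.2 (hIm.trans_lt
        (maximalIdeal.isMaximal A).ne_top.lt_top).ne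
      have hdim := Module.supportDim_quotSMulTop_succ_eq_supportDim hxreg hx
      have hsuppI : Module.support A (A ⧸ I) = PrimeSpectrum.zeroLocus I := by
        rw [Module.support_eq_zeroLocus, Ideal.annihilator_quotient]
      rw [show Module.supportDim A (A ⧸ I) = Module.supportDim A N by
        rw [Module.supportDim, Module.supportDim, hsuppI, hsupp]] at hdim
      have : Nontrivial (QuotSMulTop x (A ⧸ I)) := nontrivial_quotSMulTop_of_mem_maximalIdeal _ hx
      have hle := hdim.trans_le hN
      cases e with
      | zero =>
        have hbot := Module.supportDim_ne_bot_of_nontrivial A (QuotSMulTop x (A ⧸ I))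
        generalize Module.supportDim A (QuotSMulTop x (A ⧸ I)) = D at hle hbot
        induction D with
        | bot => exact absurd rfl hbot
        | coe D =>
          have : D + 1 ≤ 0 := by exact_mod_cast hle
          simp at this
      | succ e =>
        have hle' : Module.supportDim A (QuotSMulTop x (A ⧸ I)) ≤ e :=
          ENat.WithBot.add_le_add_one_right_iff.1 (by exact_mod_cast hle)
        obtain ⟨rs', hlen, hmem', hreg'⟩ := exists_isRegular_of_exists_subsingleton_ext I (i + 1) L
          (hlt I hIm) (ModuleCat.of A (A ⧸ I)) hsuppI fun j hj =>
            subsingleton_ext_of_subsingleton_ext_quotSMulTop _ _ hx hxreg j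
              (ih e e.lt_succ_self _ hle' _ (by omega))
        exact subsingleton_ext_of_exists_isRegular I N hsupp.subset L (hlt I hIm) rs' hmem'
          hreg' i (by omega)

theorem CategoryTheory.ProjectiveResolution.exactAt_linearYonedaObj_iff_subsingleton_ext
    {A : Type*} [Ring A] {C : Type u} [Category.{v} C] [Abelian C] [Linear A C] [HasExt.{w} C]
    {X : C} (P : ProjectiveResolution X) (Y : C) (n : ℕ) :
    (P.complex.linearYonedaObj A Y).ExactAt n ↔ Subsingleton (Abelian.Ext X Y n) := by
  cases n with
  | zero =>
    rw [HomologicalComplex.exactAt_iff' _ 0 0 1 (by simp) (by simp),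
      ShortComplex.moduleCat_exact_iff, Abelian.Ext.addEquiv₀.subsingleton_congr]
    constructor
    · intro h
      refine subsingleton_of_forall_eq 0 fun f => ?_
      have hπf : P.π.f 0 ≫ f = 0 := by
        obtain ⟨(g : P.complex.X 0 ⟶ Y), hg⟩ := h (P.π.f 0 ≫ f)
          ((P.complex_d_comp_π_f_zero_assoc f).trans Limits.zero_comp)
        exact hg.symm.trans (show P.complex.d 0 0 ≫ g = 0 by simp)
      exact (cancel_epi (P.π.f 0)).1 (hπf.trans Limits.comp_zero.symm)
    · intro h (f : P.complex.X 0 ⟶ Y) (hf : P.complex.d 1 0 ≫ f = 0)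
      refine ⟨0, (map_zero _).trans ?_⟩
      have hg : P.π.f 0 ≫ P.exact₀.desc f hf = f := P.exact₀.g_desc f hf
      have h0 : P.exact₀.desc f hf = 0 := h.elim (α := X ⟶ Y) _ _
      rw [← hg, h0]
      exact Limits.comp_zero.symm
  | succ n =>
    rw [HomologicalComplex.exactAt_iff' _ n (n + 1) (n + 2) (by simp) (by simp),
      ShortComplex.moduleCat_exact_iff]
    constructor
    · intro h
      refine subsingleton_of_forall_eq 0 fun α => ?_
      obtain ⟨f, hf, rfl⟩ := P.extMk_surjective α (n + 2) rfl
      exact (P.extMk_eq_zero_iff f _ rfl hf n rfl).2 (h f hf)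
    · intro h f (hf : P.complex.d (n + 2) (n + 1) ≫ f = 0)
      exact (P.extMk_eq_zero_iff f _ rfl hf n rfl).1 (h.elim _ _)

theorem CategoryTheory.nontrivial_ext_iff_nontrivial_abelianExt
    {A : Type*} [Ring A] {C : Type u} [Category.{v} C] [Abelian C] [Linear A C]
    [EnoughProjectives C] [HasExt.{w} C] (X Y : C) (n : ℕ) :
    Nontrivial (((Ext A C n).obj (Opposite.op X)).obj Y) ↔ Nontrivial (Abelian.Ext X Y n) := by
  rw [← not_subsingleton_iff_nontrivial, ← not_subsingleton_iff_nontrivial, not_iff_not,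
    ← (projectiveResolution X).exactAt_linearYonedaObj_iff_subsingleton_ext (A := A),
    HomologicalComplex.exactAt_iff_isZero_homology,
    ← ((projectiveResolution X).isoExt (R := A) n Y).isZero_iff, ModuleCat.isZero_iff_subsingleton]

theorem LTSeries.height_head_add_length_le {α : Type*} [Preorder α] (p : LTSeries α) :
    Order.height p.head + p.length ≤ Order.height p.last := by
  have (i : ℕ) (hi : i < p.length + 1) : Order.height p.head + i ≤ Order.height (p ⟨i, hi⟩) := by
    induction i with
    | zero => simp [RelSeries.head]
    | succ i ih =>
      calc Order.height p.head + (i + 1 : ℕ) = Order.height p.head + i + 1 := by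
            push_cast; rw [add_assoc]
        _ ≤ Order.height (p ⟨i, by omega⟩) + 1 := by gcongr; exact ih _
        _ ≤ _ := Order.height_add_one_le (p.strictMono (by simp))
  exact this p.length (by omega)

theorem Module.iInf_height_support_add_supportDim_le_ringKrullDim (A M : Type*) [CommRing A]
    [AddCommGroup M] [Module A M] :
    ((⨅ P ∈ Module.support A M, Order.height P : ℕ∞) : WithBot ℕ∞) + Module.supportDim A M ≤
      ringKrullDim A := by
  cases subsingleton_or_nontrivial M
  · simp [Module.supportDim_eq_bot_of_subsingleton]
  have : Nonempty (Module.support A M) := Module.nonempty_support_of_nontrivial.to_subtype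
  have : Nonempty (PrimeSpectrum A) := this.map Subtype.val
  rw [Module.supportDim, Order.krullDim_eq_iSup_length, ← WithBot.coe_add, ENat.add_iSup,
    ringKrullDim, Order.krullDim_eq_iSup_height_of_nonempty, WithBot.coe_le_coe]
  refine iSup_le fun p => ?_
  let q := p.map Subtype.val (Subtype.strictMono_coe _)
  calc _ ≤ Order.height q.head + q.length := by
        gcongr
        · exact iInf₂_le _ p.head.2
        · simp [q]
    _ ≤ Order.height q.last := q.height_head_add_length_le
    _ ≤ _ := le_iSup (fun x : PrimeSpectrum A => Order.height x) q.last

theorem RingTheory.Sequence.IsWeaklyRegular.length_le_height {A : Type*} [CommRing A]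
    [IsNoetherianRing A] {rs : List A} (h : IsWeaklyRegular A rs) (P : Ideal A) [P.IsPrime]
    (hmem : ∀ r ∈ rs, r ∈ P) : rs.length ≤ P.height := by
  have hreg := h.isRegular_of_isLocalization_of_mem (Localization.AtPrime P) P hmem
  have hdim := ringKrullDim_add_length_eq_ringKrullDim_of_isRegular _ hreg
  rw [IsLocalization.AtPrime.ringKrullDim_eq_height P (Localization.AtPrime P),
    List.length_map] at hdim
  have : Nontrivial (Localization.AtPrime P ⧸
      Ideal.ofList (rs.map (algebraMap A (Localization.AtPrime P)))) :=
    Ideal.Quotient.nontrivial_iff.2 (by simpa using hreg.top_ne_smul.symm)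
  have h0 := ringKrullDim_nonneg_of_nontrivial (R := Localization.AtPrime P ⧸
      Ideal.ofList (rs.map (algebraMap A (Localization.AtPrime P))))
  have : (rs.length : WithBot ℕ∞) ≤ P.height := hdim ▸ le_add_of_nonneg_left h0
  exact_mod_cast this

theorem Module.iInf_height_support_le_of_nontrivial_ext {A : Type u} [CommRing A]
    [IsNoetherianRing A] [IsLocalRing A] {s : Finset A}
    (hs : Ideal.span (s : Set A) = maximalIdeal A)
    (hcard : (s.card : WithBot ℕ∞) = ringKrullDim A) (M : ModuleCat.{u} A) [Module.Finite A M]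
    {i : ℕ} (hi : Nontrivial (Abelian.Ext M (ModuleCat.of A A) i)) :
    ⨅ P ∈ Module.support A M, Order.height P ≤ (i : ℕ∞) := by
  have hM : Nontrivial M := by
    by_contra hM
    have hM := not_nontrivial_iff_subsingleton.1 hM
    have h0 : 𝟙 M = 0 := (ModuleCat.isZero_of_subsingleton M).eq_of_src _ _
    refine not_subsingleton_iff_nontrivial.2 hi (subsingleton_of_forall_eq 0 fun x => ?_)
    rw [← Abelian.Ext.mk₀_id_comp x, h0, Abelian.Ext.mk₀_zero, Abelian.Ext.zero_comp]
  obtain ⟨-, rs, hlen, hmem, hreg⟩ :=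
    isDomain_and_exists_isWeaklyRegular_of_card_le_ringKrullDim s.card s hs le_rfl hcard.le
  by_contra! hlt
  have hle := Module.iInf_height_support_add_supportDim_le_ringKrullDim A M
  obtain ⟨d, hd⟩ := WithBot.ne_bot_iff_exists.1 (Module.supportDim_ne_bot_of_nontrivial A M)
  rw [← hcard, ← hd] at hle
  have hle : (⨅ P ∈ Module.support A M, Order.height P) + d ≤ (s.card : ℕ∞) := by
    exact_mod_cast hle
  obtain ⟨e, rfl⟩ := ENat.ne_top_iff_exists.1
    (ne_top_of_le_ne_top (ENat.natCast_ne_top _) (le_of_add_le_right hle))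
  refine not_subsingleton_iff_nontrivial.2 hi <|
    ModuleCat.subsingleton_ext_of_add_supportDim_lt hmem (ModuleCat.of A A) hreg e M hd.ge i ?_
  have : (i + 1 + e : ℕ∞) ≤ s.card := (add_le_add_left (Order.add_one_le_of_lt hlt) _).trans hle
  have : i + 1 + e ≤ s.card := by exact_mod_cast this
  omega

theorem Module.exists_nontrivial_ext_of_mem_support {A : Type u} [CommRing A] [IsNoetherianRing A]
    [IsLocalRing A] (M : ModuleCat.{u} A) [Module.Finite A M] {P : PrimeSpectrum A}
    (hP : P ∈ Module.support A M) :
    ∃ i : ℕ, (i : ℕ∞) ≤ Order.height P ∧ Nontrivial (Abelian.Ext M (ModuleCat.of A A) i) := by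
  by_contra! h
  rw [← PrimeSpectrum.height_eq_orderHeight] at h
  obtain ⟨n, hn⟩ := ENat.ne_top_iff_exists.1 (Ideal.height_ne_top P.2.ne_top)
  have hMP := hP
  rw [Module.support_eq_zeroLocus] at hMP
  obtain ⟨rs, hlen, hmem, hreg⟩ := ModuleCat.exists_isRegular_of_exists_subsingleton_ext
    (Module.annihilator A M) (n + 1) (ModuleCat.of A A)
    (by
      rw [smul_eq_mul, Ideal.mul_top]
      exact lt_top_iff_ne_top.2 fun h => P.2.ne_top (top_le_iff.1 (h ▸ hMP)))
    M Module.support_eq_zeroLocus fun i hi => not_nontrivial_iff_subsingleton.1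
      (fun hi' => not_subsingleton_iff_nontrivial.2 hi' (h i (by
        rw [← hn]; exact_mod_cast Nat.le_of_lt_succ hi)))
  have := hreg.toIsWeaklyRegular.length_le_height P.asIdeal fun r hr => hMP (hmem r hr)
  rw [hlen, ← hn] at this
  have : n + 1 ≤ n := by exact_mod_cast this
  omega

end

/-- Over a regular local Noetherian ring `A` (regularity expressed as: the maximal
ideal is generated by `dim A` elements), for a finitely generated module `M` the
codimension of the support of `M` (the infimum of the heights of the primes in the
support, `⊤` if `M = 0`) equals `inf { j : Ext^j_A(M, A) ≠ 0 }` (`⊤` if empty). -/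
theorem codim_support_eq_inf_ext
    (A : Type) [CommRing A] [IsNoetherianRing A] [IsLocalRing A]
    (hreg : ∃ s : Finset A, Ideal.span (s : Set A) = IsLocalRing.maximalIdeal A ∧
      (s.card : WithBot (WithTop ℕ)) = ringKrullDim A)
    (M : Type) [AddCommGroup M] [Module A M] [Module.Finite A M] :
    sInf {h : ℕ∞ | ∃ P ∈ Module.support A M, h = Order.height P} =
    sInf {j : ℕ∞ | ∃ i : ℕ, j = (i : ℕ∞) ∧
      Nontrivial (((Ext A (ModuleCat A) i).obj
        (Opposite.op (ModuleCat.of A M))).obj (ModuleCat.of A A))} := by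
  refine le_antisymm (le_sInf ?_) (le_sInf ?_)
  · rintro _ ⟨i, rfl, hi⟩
    obtain ⟨s, hs, hcard⟩ := hreg
    refine le_trans (le_iInf₂ fun P hP => sInf_le ⟨P, hP, rfl⟩)
      (Module.iInf_height_support_le_of_nontrivial_ext hs hcard (ModuleCat.of A M)
        ((nontrivial_ext_iff_nontrivial_abelianExt _ _ _).1 hi))
  · rintro _ ⟨P, hP, rfl⟩
    obtain ⟨i, hi, hnt⟩ := Module.exists_nontrivial_ext_of_mem_support (ModuleCat.of A M) hP
    exact sInf_le_of_le ⟨i, rfl, (nontrivial_ext_iff_nontrivial_abelianExt _ _ _).2 hnt⟩ hi
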